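/- arXiv:1108.4123 — 8 statements merged into one kernel-verified Lean document; each statement's English description precedes it below -/
import Mathlib

section
/- There exists ε₁ > 0, depending only on φ and γ₀, such that for every η ∈ ℝ with |η| < 1 satisfying |arctan η − θ_j| > γ₀ for all j = 1,…,R, one has |K_φ(1,η)| ≥ ε₁ · φ'(1,η)². -/
/-- The determinant of the Hessian of a function `φ : ℝ → ℝ → ℝ` (curried) at `(ξ, μ)`. -/
noncomputable def Kdet (φ : ℝ → ℝ → ℝ) (ξ μ : ℝ) : ℝ :=
  iteratedDeriv 2 (fun s => φ s μ) ξ * iteratedDeriv 2 (fun t => φ ξ t) μ -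
    (deriv (fun s => deriv (fun t => φ s t) μ) ξ) ^ 2

/-- The derivative of a smooth family of functions depends smoothly on the parameter. -/
theorem ContDiff.deriv_family {E : Type*} [NormedAddCommGroup E] [NormedSpace ℝ E]
    {f : E → ℝ → ℝ} {g : E → ℝ} (hf : ContDiff ℝ (⊤ : ℕ∞) (Function.uncurry f))
    (hg : ContDiff ℝ (⊤ : ℕ∞) g) : ContDiff ℝ (⊤ : ℕ∞) (fun x => deriv (f x) (g x)) :=
  ContDiff.fderiv_apply hf hg contDiff_const (by simp)

/-- The Hessian determinant of a smooth function is continuous along `ξ = 1`. -/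
theorem continuous_Kdet_one {φ : ℝ → ℝ → ℝ} (hφ : ContDiff ℝ (⊤ : ℕ∞) (Function.uncurry φ)) :
    Continuous (Kdet φ 1) := by
  have hswap : ContDiff ℝ (⊤ : ℕ∞) (Function.uncurry fun t s => φ s t) :=
    hφ.comp (contDiff_snd.prodMk contDiff_fst)
  have second {f : ℝ → ℝ → ℝ} {g h : ℝ → ℝ} (hf : ContDiff ℝ (⊤ : ℕ∞) (Function.uncurry f))
      (hg : ContDiff ℝ (⊤ : ℕ∞) g) (hh : ContDiff ℝ (⊤ : ℕ∞) h) :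
      Continuous fun η => iteratedDeriv 2 (f (h η)) (g η) := by
    simp only [iteratedDeriv_succ, iteratedDeriv_zero]
    refine (ContDiff.deriv_family (f := fun x => deriv (f (h x))) ?_ hg).continuous
    exact ContDiff.deriv_family (f := fun p : ℝ × ℝ => f (h p.1)) (g := Prod.snd)
      (hf.comp ((hh.comp (contDiff_fst.comp contDiff_fst)).prodMk contDiff_snd)) contDiff_snd
  have mixed : Continuous fun η => deriv (fun s => deriv (fun t => φ s t) η) 1 := by
    refine (ContDiff.deriv_family (f := fun η s => deriv (fun t => φ s t) η) ?_
      contDiff_const).continuous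
    exact ContDiff.deriv_family (f := fun p : ℝ × ℝ => φ p.2) (g := Prod.fst)
      (hφ.comp ((contDiff_snd.comp contDiff_fst).prodMk contDiff_snd)) contDiff_fst
  exact ((second hswap contDiff_const contDiff_id).mul
    (second hφ contDiff_id contDiff_const)).sub (mixed.pow 2)

/-- On a compact set, a nonvanishing continuous function dominates a multiple of the square of
any other continuous function. -/
theorem IsCompact.exists_pos_mul_sq_le_abs {X : Type*} [TopologicalSpace X] {S : Set X}
    (hS : IsCompact S) {f g : X → ℝ} (hf : ContinuousOn f S) (hg : ContinuousOn g S)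
    (hne : ∀ x ∈ S, f x ≠ 0) : ∃ ε > (0 : ℝ), ∀ x ∈ S, ε * g x ^ 2 ≤ |f x| := by
  obtain ⟨M, hM⟩ := hS.exists_bound_of_continuousOn ((hg.pow 2).div hf.abs
    fun x hx => abs_ne_zero.2 (hne x hx))
  refine ⟨(|M| + 1)⁻¹, by positivity, fun x hx => ?_⟩
  have hfx : 0 < |f x| := abs_pos.2 (hne x hx)
  have hle : g x ^ 2 / |f x| ≤ |M| + 1 := by
    have := (le_abs_self _).trans (hM x hx)
    have := le_abs_self M
    simp only [Pi.div_apply, Pi.pow_apply] at *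
    linarith
  rw [div_le_iff₀ hfx] at hle
  rwa [inv_mul_le_iff₀ (by positivity)]

/-- Away from the angular neighborhoods of the zeros of `K_φ(1,·)` in `[-1,1]`,
one has `|K_φ(1,η)| ≥ ε₁ φ'(1,η)²`. -/
theorem stmt3 (d : ℕ) (hd : 2 ≤ d) (a : ℕ → ℝ) (φ : ℝ → ℝ → ℝ)
    (hφ : ∀ ξ μ : ℝ, φ ξ μ = ∑ i ∈ Finset.range (d + 1), a i * ξ ^ i * μ ^ (d - i))
    (hK : ∃ η : ℝ, Kdet φ 1 η ≠ 0)
    (R : ℕ) (ω : Fin R → ℝ)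
    (hωmem : ∀ j, ω j ∈ Set.Icc (-1 : ℝ) 1)
    (hωzero : ∀ j, Kdet φ 1 (ω j) = 0)
    (hzeros : ∀ η ∈ Set.Icc (-1 : ℝ) 1, Kdet φ 1 η = 0 → ∃ j, η = ω j)
    (γ₀ : ℝ) (hγ₀ : 0 < γ₀)
    (hsep : ∀ (j : Fin R) (η : ℝ), |Real.arctan η - Real.arctan (ω j)| ≤ γ₀ →
      Kdet φ 1 η = 0 → η = ω j) :
    ∃ ε₁ > (0 : ℝ), ∀ η : ℝ, |η| < 1 →
      (∀ j : Fin R, γ₀ < |Real.arctan η - Real.arctan (ω j)|) →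
      ε₁ * (deriv (φ 1) η) ^ 2 ≤ |Kdet φ 1 η| := by
  have hsmooth : ContDiff ℝ (⊤ : ℕ∞) (Function.uncurry φ) := by
    have : Function.uncurry φ = fun p : ℝ × ℝ =>
        ∑ i ∈ Finset.range (d + 1), a i * p.1 ^ i * p.2 ^ (d - i) := funext fun p => hφ p.1 p.2
    rw [this]
    fun_prop
  have hderiv : Continuous (deriv (φ 1)) :=
    (ContDiff.deriv_family (f := fun _ : ℝ => φ 1) (g := id)
      (hsmooth.comp (contDiff_const.prodMk contDiff_snd)) contDiff_id).continuous
  have hclosed : IsClosed {η : ℝ | ∀ j, γ₀ ≤ |Real.arctan η - Real.arctan (ω j)|} := by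
    simp only [Set.ofPred_forall]
    exact isClosed_iInter fun j => isClosed_le continuous_const
      (Real.continuous_arctan.sub continuous_const).abs
  obtain ⟨ε, hε, h⟩ := ((isCompact_Icc (a := (-1 : ℝ)) (b := 1)).inter_right
    hclosed).exists_pos_mul_sq_le_abs (continuous_Kdet_one hsmooth).continuousOn
    hderiv.continuousOn (by
      rintro η ⟨hη, hfar⟩ hzero
      obtain ⟨j, rfl⟩ := hzeros η hη hzero
      have := hfar j
      simp only [sub_self, abs_zero] at this
      linarith)
  exact ⟨ε, hε, fun η hη hfar => h η ⟨abs_le.1 hη.le, fun j => (hfar j).le⟩⟩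
end

section
/- Suppose that for some j ∈ {1,…,R} one has φ'(1,ω_j) = 0. Then there exists ε₂ > 0, depending only on φ and γ₀, such that for every η ∈ ℝ with |η| < 1 and |arctan η − θ_j| < γ₀, one has |K_φ(1,η)| ≥ ε₂ · φ'(1,η)². -/
open Polynomial in
/-- Over `ℝ`, the order of vanishing of `d p p'' - (d - 1) p'²` at a critical point of `p` is at
most twice the order of vanishing of `p'`, provided `deg p ≤ d`. -/
theorem X_sub_C_pow_rootMultiplicity_dvd_derivative_sq (p : ℝ[X]) (d : ℕ) (hd : 0 < d)
    (hdeg : p.natDegree ≤ d) (w : ℝ) (hw : p.derivative.IsRoot w) {K : ℝ[X]}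
    (hK : K = C (d : ℝ) * p * p.derivative.derivative - C ((d : ℝ) - 1) * p.derivative ^ 2)
    (hK0 : K ≠ 0) :
    (X - C w) ^ K.rootMultiplicity w ∣ p.derivative ^ 2 := by
  rcases eq_or_ne p.derivative 0 with h0 | h0
  · simp [h0]
  obtain ⟨r, hr, hrL⟩ := exists_eq_pow_rootMultiplicity_mul_and_not_dvd p.derivative h0 w
  have hpos : 0 < p.derivative.rootMultiplicity w := (rootMultiplicity_pos h0).2 hw
  obtain ⟨m, hm⟩ := Nat.exists_eq_succ_of_ne_zero hpos.ne'
  rw [hm, Nat.succ_eq_add_one] at hr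
  rcases le_or_gt (K.rootMultiplicity w) (2 * (m + 1)) with hle | hgt
  · refine (pow_dvd_pow _ hle).trans ?_
    rw [hr]
    exact ⟨r ^ 2, by ring⟩
  exfalso
  obtain ⟨S, hS⟩ := (pow_dvd_pow (X - C w) (show 2 * m + 3 ≤ _ by omega)).trans
    (pow_rootMultiplicity_dvd K w)
  have hrw : r.eval w ≠ 0 := fun h => hrL (dvd_iff_isRoot.2 h)
  have hL0 : (X - C w) ≠ 0 := X_sub_C_ne_zero w
  have hLprime : Prime (X - C w) := prime_X_sub_C w
  have hdR : (d : ℝ) ≠ 0 := by exact_mod_cast hd.ne'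
  obtain ⟨u, hu⟩ : ∃ u, u = C ((m : ℝ) + 1) * r + (X - C w) * r.derivative := ⟨_, rfl⟩
  have hp2 : p.derivative.derivative = (X - C w) ^ m * u := by
    rw [hr, hu]
    simp [derivative_mul, derivative_X_sub_C_pow]
    ring
  have huw : u.eval w ≠ 0 := by
    simpa [hu, hrw] using (by positivity : (m : ℝ) + 1 ≠ 0)
  have huL : ¬ (X - C w) ∣ u := fun h => huw (dvd_iff_isRoot.1 h)
  have key : C (d : ℝ) * p * u =
      (X - C w) ^ (m + 2) * ((X - C w) * S + C ((d : ℝ) - 1) * r ^ 2) := by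
    apply mul_left_cancel₀ (pow_ne_zero m hL0)
    have h1 := hK
    rw [hS, hp2, hr] at h1
    linear_combination -h1
  have hdvd : (X - C w) ^ (m + 2) ∣ C (d : ℝ) * p :=
    hLprime.pow_dvd_of_dvd_mul_right _ huL ⟨_, key⟩
  obtain ⟨q, hq⟩ := ((isUnit_C.2 (isUnit_iff_ne_zero.2 hdR)).dvd_mul_left).1 hdvd
  have hrq : r = C ((m : ℝ) + 2) * q + (X - C w) * q.derivative := by
    apply mul_left_cancel₀ (pow_ne_zero (m + 1) hL0)
    have h1 : p.derivative = _ := congrArg derivative hq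
    simp only [derivative_mul, derivative_X_sub_C_pow] at h1
    rw [← hr, h1]
    simp
    ring
  have key2 : C (d : ℝ) * q * u = (X - C w) * S + C ((d : ℝ) - 1) * r ^ 2 := by
    apply mul_left_cancel₀ (pow_ne_zero (m + 2) hL0)
    rw [← key, hq]
    ring
  have hrw' : r.eval w = (m + 2) * q.eval w := by simp [hrq]
  have hqw : q.eval w ≠ 0 := fun h => hrw (by simp [hrw', h])
  have hdm : d = m + 2 := by
    have h1 := congrArg (eval w) key2
    simp only [hu, eval_mul, eval_add, eval_sub, eval_C, eval_X, eval_pow, hrw', sub_self,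
      zero_mul, add_zero, zero_add] at h1
    have h2 : ((m : ℝ) + 2) * (q.eval w) ^ 2 * ((d : ℝ) - (m + 2)) = 0 := by
      linear_combination -h1
    have h3 : ((m : ℝ) + 2) * (q.eval w) ^ 2 ≠ 0 :=
      mul_ne_zero (by positivity) (pow_ne_zero 2 hqw)
    have h4 := (mul_eq_zero.1 h2).resolve_left h3
    exact_mod_cast sub_eq_zero.1 h4
  have hq0 : q ≠ 0 := by rintro rfl; simp at hqw
  have hqdeg : q.natDegree = 0 := by
    have h1 := hdeg
    rw [hq, natDegree_mul (pow_ne_zero _ hL0) hq0, natDegree_pow, natDegree_X_sub_C] at h1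
    omega
  obtain ⟨c, rfl⟩ := natDegree_eq_zero.1 hqdeg
  apply hK0
  have hr' : r = C ((m : ℝ) + 2) * C c := by simpa using hrq
  have hu' : u = C ((m : ℝ) + 1) * (C ((m : ℝ) + 2) * C c) := by
    rw [hu, hr', ← C_mul, derivative_C, mul_zero, add_zero]
  rw [hK, hp2, hr, hq, hu', hr', hdm]
  simp only [C_add, C_sub, C_1, Nat.cast_add]
  have h2 : (C (2 : ℝ)) = 2 := rfl
  simp [h2]
  ring

theorem iteratedDeriv_two_eval (q : Polynomial ℝ) (x : ℝ) :
    iteratedDeriv 2 (fun t => q.eval t) x = q.derivative.derivative.eval x := by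
  have h : deriv (fun t => q.eval t) = fun t => q.derivative.eval t :=
    funext fun _ => Polynomial.deriv _
  rw [iteratedDeriv_succ, iteratedDeriv_one, h, Polynomial.deriv]

open Polynomial in
/-- The Hessian determinant of a binary form of degree `d` on the line `ξ = 1`, in terms of its
dehomogenization. -/
theorem Kdet_one_eq (d : ℕ) (a : ℕ → ℝ) (φ : ℝ → ℝ → ℝ)
    (hφ : ∀ ξ μ : ℝ, φ ξ μ = ∑ i ∈ Finset.range (d + 1), a i * ξ ^ i * μ ^ (d - i))
    {p : ℝ[X]} (hp : p = ∑ i ∈ Finset.range (d + 1), C (a i) * X ^ (d - i)) (η : ℝ) :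
    Kdet φ 1 η = ((d : ℝ) - 1) * (d * p.eval η * p.derivative.derivative.eval η -
      (d - 1) * (p.derivative.eval η) ^ 2) := by
  have hμ : φ 1 = fun t => p.eval t := by
    funext t; simp [hφ, hp, eval_finsetSum]
  have hμμ : iteratedDeriv 2 (fun t => φ 1 t) η = p.derivative.derivative.eval η := by
    rw [hμ, iteratedDeriv_two_eval]
  have h1 : p.derivative.eval η =
      ∑ i ∈ Finset.range (d + 1), a i * (d - i : ℕ) * η ^ (d - i - 1) := by
    simp only [hp, derivative_sum, derivative_C_mul, derivative_X_pow, eval_finsetSum, eval_mul,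
      eval_C, eval_pow, eval_X, mul_assoc]
  have h1' : η * p.derivative.eval η =
      ∑ i ∈ Finset.range (d + 1), a i * (d - i : ℕ) * η ^ (d - i) := by
    rw [h1, Finset.mul_sum]
    refine Finset.sum_congr rfl fun i _ => ?_
    rcases d - i with _ | k
    · simp
    · simp; ring
  have h2 : η * p.derivative.derivative.eval η = ∑ i ∈ Finset.range (d + 1),
      a i * ((d - i : ℕ) : ℝ) * (((d - i : ℕ) : ℝ) - 1) * η ^ (d - i - 1) := by
    simp only [hp, derivative_sum, derivative_C_mul, derivative_X_pow, eval_finsetSum, eval_mul,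
      eval_C, eval_pow, eval_X, Finset.mul_sum]
    refine Finset.sum_congr rfl fun i _ => ?_
    rcases d - i with _ | _ | k
    · simp
    · simp
    · simp; ring
  have h2' : η ^ 2 * p.derivative.derivative.eval η = ∑ i ∈ Finset.range (d + 1),
      a i * ((d - i : ℕ) : ℝ) * (((d - i : ℕ) : ℝ) - 1) * η ^ (d - i) := by
    rw [sq, mul_assoc, h2, Finset.mul_sum]
    refine Finset.sum_congr rfl fun i _ => ?_
    rcases d - i with _ | k
    · simp
    · simp; ring
  have hξξ : iteratedDeriv 2 (fun s => φ s η) 1 =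
      d * (d - 1) * p.eval η - 2 * (d - 1) * (η * p.derivative.eval η) +
        η ^ 2 * p.derivative.derivative.eval η := by
    have hfun : (fun s => φ s η) = fun s =>
        (∑ i ∈ Finset.range (d + 1), C (a i * η ^ (d - i)) * X ^ i : ℝ[X]).eval s := by
      funext s
      simp only [hφ, eval_finsetSum, eval_mul, eval_C, eval_pow, eval_X]
      exact Finset.sum_congr rfl fun i _ => by ring
    rw [hfun, iteratedDeriv_two_eval]
    rw [h1', h2', hp]
    simp only [derivative_sum, derivative_C_mul, derivative_X_pow, eval_finsetSum, eval_mul,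
      eval_C, eval_pow, eval_X, Finset.mul_sum, one_pow, ← Finset.sum_sub_distrib,
      ← Finset.sum_add_distrib]
    refine Finset.sum_congr rfl fun i hi => ?_
    rw [Nat.cast_sub (Nat.lt_succ_iff.1 (Finset.mem_range.1 hi))]
    rcases i with _ | k
    · simp; ring
    · simp; ring
  have hξμ : deriv (fun s => deriv (fun t => φ s t) η) 1 =
      (d - 1) * p.derivative.eval η - η * p.derivative.derivative.eval η := by
    have hinner : (fun s => deriv (fun t => φ s t) η) = fun s =>
        (∑ i ∈ Finset.range (d + 1),
          C (a i * (d - i : ℕ) * η ^ (d - i - 1)) * X ^ i : ℝ[X]).eval s := by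
      funext s
      have hfun : (fun t => φ s t) = fun t =>
          (∑ i ∈ Finset.range (d + 1), C (a i * s ^ i) * X ^ (d - i) : ℝ[X]).eval t := by
        funext t
        simp [hφ, eval_finsetSum]
      rw [hfun, Polynomial.deriv]
      simp only [derivative_sum, derivative_C_mul, derivative_X_pow, eval_finsetSum, eval_mul,
        eval_C, eval_pow, eval_X]
      exact Finset.sum_congr rfl fun i _ => by ring
    rw [hinner, Polynomial.deriv, h1, h2]
    simp only [derivative_sum, derivative_C_mul, derivative_X_pow, eval_finsetSum, eval_mul,
      eval_C, eval_pow, eval_X, Finset.mul_sum, one_pow, ← Finset.sum_sub_distrib]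
    refine Finset.sum_congr rfl fun i hi => ?_
    rw [Nat.cast_sub (Nat.lt_succ_iff.1 (Finset.mem_range.1 hi))]
    ring
  rw [Kdet, hξξ, hμμ, hξμ]
  ring

/-- If `ω_j` is a zero of `K_φ(1,·)` in `[-1,1]` with `φ'(1,ω_j) = 0`, then
`|K_φ(1,η)| ≥ ε₂ φ'(1,η)²` throughout the angular `γ₀`-neighborhood of `ω_j`. -/
theorem stmt4 (d : ℕ) (hd : 2 ≤ d) (a : ℕ → ℝ) (φ : ℝ → ℝ → ℝ)
    (hφ : ∀ ξ μ : ℝ, φ ξ μ = ∑ i ∈ Finset.range (d + 1), a i * ξ ^ i * μ ^ (d - i))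
    (hK : ∃ η : ℝ, Kdet φ 1 η ≠ 0)
    (R : ℕ) (ω : Fin R → ℝ)
    (hωmem : ∀ j, ω j ∈ Set.Icc (-1 : ℝ) 1)
    (hωzero : ∀ j, Kdet φ 1 (ω j) = 0)
    (hzeros : ∀ η ∈ Set.Icc (-1 : ℝ) 1, Kdet φ 1 η = 0 → ∃ j, η = ω j)
    (γ₀ : ℝ) (hγ₀ : 0 < γ₀)
    (hsep : ∀ (j : Fin R) (η : ℝ), |Real.arctan η - Real.arctan (ω j)| ≤ γ₀ →
      Kdet φ 1 η = 0 → η = ω j)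
    (j : Fin R) (hj : deriv (φ 1) (ω j) = 0) :
    ∃ ε₂ > (0 : ℝ), ∀ η : ℝ, |η| < 1 →
      |Real.arctan η - Real.arctan (ω j)| < γ₀ →
      ε₂ * (deriv (φ 1) η) ^ 2 ≤ |Kdet φ 1 η| := by
  open Polynomial in
  obtain ⟨p, hp⟩ : ∃ p : ℝ[X], p = ∑ i ∈ Finset.range (d + 1), C (a i) * X ^ (d - i) := ⟨_, rfl⟩
  have hφ1 : φ 1 = fun t => p.eval t := by
    funext t; simp [hφ, hp, Polynomial.eval_finsetSum]
  have hdeg : p.natDegree ≤ d := by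
    rw [hp]
    exact Polynomial.natDegree_sum_le_of_forall_le _ _ fun i _ =>
      (Polynomial.natDegree_C_mul_X_pow_le _ _).trans (Nat.sub_le _ _)
  have hderiv : ∀ η, deriv (φ 1) η = p.derivative.eval η := fun η => by
    rw [hφ1, Polynomial.deriv]
  have hKp := Kdet_one_eq d a φ hφ hp
  have hd1 : (0 : ℝ) < (d : ℝ) - 1 := by
    have : (2 : ℝ) ≤ d := by exact_mod_cast hd
    linarith
  open Polynomial in
  obtain ⟨K, hKdef⟩ : ∃ K : ℝ[X], K = C (d : ℝ) * p * p.derivative.derivative -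
    C ((d : ℝ) - 1) * p.derivative ^ 2 := ⟨_, rfl⟩
  have hKeval : ∀ η, Kdet φ 1 η = ((d : ℝ) - 1) * K.eval η := fun η => by
    rw [hKp, hKdef]; simp
  have hK0 : K ≠ 0 := by
    rintro h
    obtain ⟨η, hη⟩ := hK
    exact hη (by simp [hKeval, h])
  obtain ⟨S, hS, hSL⟩ := Polynomial.exists_eq_pow_rootMultiplicity_mul_and_not_dvd K hK0 (ω j)
  obtain ⟨G, hG⟩ := X_sub_C_pow_rootMultiplicity_dvd_derivative_sq p d (by omega) hdeg (ω j)
    ((hderiv _).symm.trans hj) hKdef hK0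
  set n := K.rootMultiplicity (ω j)
  obtain ⟨s, hs⟩ : ∃ s : Set ℝ, s = Set.Icc (-1) 1 ∩
    {η | |Real.arctan η - Real.arctan (ω j)| ≤ γ₀} := ⟨_, rfl⟩
  have hsc : IsCompact s := by
    rw [hs]
    refine isCompact_Icc.inter_right (isClosed_le ?_ continuous_const)
    exact (Real.continuous_arctan.sub continuous_const).abs
  have hSne : ∀ η ∈ s, S.eval η ≠ 0 := by
    intro η hη h
    rw [hs] at hη
    have : η = ω j := hsep j η hη.2 (by rw [hKeval, hS]; simp [h])
    exact hSL (Polynomial.dvd_iff_isRoot.2 (this ▸ h))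
  obtain ⟨M, hM⟩ := hsc.exists_bound_of_continuousOn (f := fun η => G.eval η / S.eval η)
    (G.continuous.continuousOn.div S.continuous.continuousOn hSne)
  refine ⟨((d : ℝ) - 1) / (|M| + 1), by positivity, fun η hη hη' => ?_⟩
  have hηs : η ∈ s := by
    rw [hs]
    exact ⟨⟨(abs_lt.1 hη).1.le, (abs_lt.1 hη).2.le⟩, hη'.le⟩
  have hGS : |G.eval η| ≤ (|M| + 1) * |S.eval η| := by
    have h1 := hM η hηs
    rw [Real.norm_eq_abs, abs_div, div_le_iff₀ (abs_pos.2 (hSne η hηs))] at h1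
    exact h1.trans (by gcongr; linarith [le_abs_self M])
  have hsq : (p.derivative.eval η) ^ 2 = |η - ω j| ^ n * |G.eval η| := by
    rw [← abs_of_nonneg (sq_nonneg (p.derivative.eval η)), ← Polynomial.eval_pow, hG]
    simp [abs_mul, abs_pow]
  have hKabs : |Kdet φ 1 η| = ((d : ℝ) - 1) * (|η - ω j| ^ n * |S.eval η|) := by
    rw [hKeval, hS, abs_mul, abs_of_pos hd1]
    simp [abs_mul, abs_pow]
  rw [hderiv, hsq, hKabs, div_mul_eq_mul_div, div_le_iff₀ (by positivity)]
  calc ((d : ℝ) - 1) * (|η - ω j| ^ n * |G.eval η|)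
      ≤ ((d : ℝ) - 1) * (|η - ω j| ^ n * ((|M| + 1) * |S.eval η|)) := by gcongr
    _ = _ := by ring
end

section
/- Suppose that for some j ∈ {1,…,R} one has φ'(1,ω_j) ≠ 0. Then there exists an invertible affine (in fact linear) transformation T_j : ℝ² → ℝ² with the following properties. Set (ξ⁰,μ⁰) = T_j(1,ω_j), η⁰ = μ⁰/ξ⁰, and φ_j = φ ∘ T_j⁻¹. Then: (i) ξ⁰ ≠ 0 and |μ⁰/ξ⁰| < 1/2; (ii) (det T_j)² · K_{φ_j}(T_j(ξ,μ)) = K_φ(ξ,μ) for all (ξ,μ) ∈ ℝ², and in particular K_{φ_j}(1,η⁰) = 0; (iii) φ_j'(1,η⁰) = 0; (iv) for every ε̃ > 0 there exists ε > 0 such that T_j maps {(ξ,μ) : |μ| < |ξ|, |arctan(μ/ξ) − θ_j| < ε} into {(ξ,μ) : |μ| < |ξ|, |arctan(μ/ξ) − arctan(η⁰)| < ε̃}. -/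
theorem hasDerivAt_prodMk_left (f : ℝ × ℝ → ℝ) (hf : Differentiable ℝ f) (s t : ℝ) :
    HasDerivAt (fun s => f (s, t)) (fderiv ℝ f (s, t) (1, 0)) s :=
  (hf (s, t)).hasFDerivAt.comp_hasDerivAt s
    ((hasDerivAt_id s).prodMk (hasDerivAt_const s t))

theorem hasDerivAt_prodMk_right (f : ℝ × ℝ → ℝ) (hf : Differentiable ℝ f) (s t : ℝ) :
    HasDerivAt (fun t => f (s, t)) (fderiv ℝ f (s, t) (0, 1)) t :=
  (hf (s, t)).hasFDerivAt.comp_hasDerivAt t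
    ((hasDerivAt_const t s).prodMk (hasDerivAt_id t))

theorem differentiable_fderiv_of_contDiff_two {f : ℝ × ℝ → ℝ} (hf : ContDiff ℝ 2 f) :
    Differentiable ℝ (fderiv ℝ f) :=
  (hf.fderiv_right (m := 1) (by norm_num)).differentiable (by norm_num)

theorem fderiv_fderiv_apply {f : ℝ × ℝ → ℝ} (hf : ContDiff ℝ 2 f) (p u v : ℝ × ℝ) :
    fderiv ℝ (fun q => fderiv ℝ f q v) p u = fderiv ℝ (fderiv ℝ f) p u v := by
  rw [fderiv_clm_apply (differentiable_fderiv_of_contDiff_two hf p) (by fun_prop)]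
  simp

/-- The Hessian determinant in terms of the second Fréchet derivative. -/
theorem Kdet_eq_fderiv {f : ℝ × ℝ → ℝ} (hf : ContDiff ℝ 2 f) (ξ μ : ℝ) :
    Kdet (fun x y => f (x, y)) ξ μ =
      fderiv ℝ (fderiv ℝ f) (ξ, μ) (1, 0) (1, 0) * fderiv ℝ (fderiv ℝ f) (ξ, μ) (0, 1) (0, 1) -
        fderiv ℝ (fderiv ℝ f) (ξ, μ) (1, 0) (0, 1) ^ 2 := by
  have hd : Differentiable ℝ f := hf.differentiable (by norm_num)
  have hd' (v : ℝ × ℝ) : Differentiable ℝ (fun q => fderiv ℝ f q v) := fun q =>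
    (differentiable_fderiv_of_contDiff_two hf q).clm_apply (by fun_prop)
  have h1 (t : ℝ) : deriv (fun s => f (s, t)) = fun s => fderiv ℝ f (s, t) (1, 0) :=
    funext fun s => (hasDerivAt_prodMk_left f hd s t).deriv
  have h2 (s : ℝ) : deriv (fun t => f (s, t)) = fun t => fderiv ℝ f (s, t) (0, 1) :=
    funext fun t => (hasDerivAt_prodMk_right f hd s t).deriv
  simp only [Kdet, iteratedDeriv_succ, iteratedDeriv_zero, h1, h2]
  rw [(hasDerivAt_prodMk_left _ (hd' (1, 0)) ξ μ).deriv,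
    (hasDerivAt_prodMk_right _ (hd' (0, 1)) ξ μ).deriv,
    (hasDerivAt_prodMk_left _ (hd' (0, 1)) ξ μ).deriv]
  simp only [fderiv_fderiv_apply hf]

theorem fderiv_fderiv_symm {f : ℝ × ℝ → ℝ} (hf : ContDiff ℝ 2 f) (p u v : ℝ × ℝ) :
    fderiv ℝ (fderiv ℝ f) p u v = fderiv ℝ (fderiv ℝ f) p v u :=
  (hf.contDiffAt.isSymmSndFDerivAt (by simp)).eq u v

/-- The determinant of a symmetric bilinear form on two vectors of the plane. -/
theorem gram_eq_det_sq_mul (B : ℝ × ℝ →L[ℝ] ℝ × ℝ →L[ℝ] ℝ) (hB : ∀ u v, B u v = B v u)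
    (α β γ δ : ℝ) :
    B (α, γ) (α, γ) * B (β, δ) (β, δ) - B (α, γ) (β, δ) ^ 2 =
      (α * δ - β * γ) ^ 2 * (B (1, 0) (1, 0) * B (0, 1) (0, 1) - B (1, 0) (0, 1) ^ 2) := by
  have h (x y : ℝ) : ((x, y) : ℝ × ℝ) = x • (1, 0) + y • (0, 1) := by simp
  rw [h α γ, h β δ]
  simp only [map_add, map_smul, add_apply, smul_apply,
    smul_eq_mul, hB (0, 1) (1, 0)]
  ring

theorem fderiv_fderiv_comp_clm {f : ℝ × ℝ → ℝ} (hf : ContDiff ℝ 2 f)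
    (L : ℝ × ℝ →L[ℝ] ℝ × ℝ) (p u v : ℝ × ℝ) :
    fderiv ℝ (fderiv ℝ (fun q => f (L q))) p u v =
      fderiv ℝ (fderiv ℝ f) (L p) (L u) (L v) := by
  have hd : Differentiable ℝ f := hf.differentiable (by norm_num)
  have h1 (q : ℝ × ℝ) : fderiv ℝ (fun q => f (L q)) q v = fderiv ℝ f (L q) (L v) := by
    have := ((hd (L q)).hasFDerivAt.comp q L.hasFDerivAt).fderiv
    exact congrArg (fun A => A v) this
  have hg : ContDiff ℝ 2 (fun q => f (L q)) := hf.comp L.contDiff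
  rw [← fderiv_fderiv_apply hg, ← fderiv_fderiv_apply hf]
  simp only [h1]
  have hd' : Differentiable ℝ (fun q => fderiv ℝ f q (L v)) := fun q =>
    (differentiable_fderiv_of_contDiff_two hf q).clm_apply (by fun_prop)
  have := ((hd' (L p)).hasFDerivAt.comp p L.hasFDerivAt).fderiv
  exact congrArg (fun A => A u) this

theorem Kdet_comp_clm {f : ℝ × ℝ → ℝ} (hf : ContDiff ℝ 2 f) (L : ℝ × ℝ →L[ℝ] ℝ × ℝ)
    (α β γ δ : ℝ) (h1 : L (1, 0) = (α, γ)) (h2 : L (0, 1) = (β, δ)) (x y : ℝ) :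
    Kdet (fun x y => f (L (x, y))) x y =
      (α * δ - β * γ) ^ 2 * Kdet (fun x y => f (x, y)) (L (x, y)).1 (L (x, y)).2 := by
  have hg : ContDiff ℝ 2 (fun q => f (L q)) := hf.comp L.contDiff
  rw [Kdet_eq_fderiv hg, Kdet_eq_fderiv hf]
  simp only [fderiv_fderiv_comp_clm hf, h1, h2]
  exact gram_eq_det_sq_mul _ (fderiv_fderiv_symm hf _) α β γ δ

/-- Euler's identity. -/
theorem fderiv_apply_self_of_homogeneous {f : ℝ × ℝ → ℝ} (hf : Differentiable ℝ f) {d : ℕ}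
    (hh : ∀ (t : ℝ) (p : ℝ × ℝ), f (t • p) = t ^ d * f p) (p : ℝ × ℝ) :
    fderiv ℝ f p p = d * f p := by
  have h1 : HasDerivAt (fun t : ℝ => f (t • p)) (fderiv ℝ f ((1 : ℝ) • p) ((1 : ℝ) • p)) 1 :=
    (hf _).hasFDerivAt.comp_hasDerivAt (1 : ℝ) ((hasDerivAt_id (1 : ℝ)).smul_const p)
  have h2 : HasDerivAt (fun t : ℝ => f (t • p)) (d * 1 ^ (d - 1) * f p) 1 := by
    simp only [hh]
    exact (hasDerivAt_pow d (1 : ℝ)).mul_const (f p)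
  simpa using h1.unique h2

/-- Euler's identity for the gradient. -/
theorem fderiv_fderiv_apply_self_of_homogeneous {f : ℝ × ℝ → ℝ} (hf : ContDiff ℝ 2 f) {d : ℕ}
    (hh : ∀ (t : ℝ) (p : ℝ × ℝ), f (t • p) = t ^ d * f p) (p u : ℝ × ℝ) :
    fderiv ℝ (fderiv ℝ f) p u p = (d - 1) * fderiv ℝ f p u := by
  have hd : Differentiable ℝ f := hf.differentiable (by norm_num)
  have h : (fun q => fderiv ℝ f q q) = fun q => (d : ℝ) * f q :=
    funext (fderiv_apply_self_of_homogeneous hd hh)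
  have h' := congrArg (fun g => fderiv ℝ g p u) h
  rw [fderiv_clm_apply (differentiable_fderiv_of_contDiff_two hf p) (by fun_prop),
    fderiv_const_mul (hd p)] at h'
  simp at h'
  linarith

/-- A zero of the Hessian determinant at which `∂f/∂μ ≠ 0` is not a zero of `f`. -/
theorem fderiv_apply_self_ne_zero {f : ℝ × ℝ → ℝ} (hf : ContDiff ℝ 2 f) {d : ℕ} (hd : 2 ≤ d)
    (hh : ∀ (t : ℝ) (p : ℝ × ℝ), f (t • p) = t ^ d * f p) {ω : ℝ}
    (hK : Kdet (fun x y => f (x, y)) 1 ω = 0) (hω : fderiv ℝ f (1, ω) (0, 1) ≠ 0) :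
    fderiv ℝ f (1, ω) (1, ω) ≠ 0 := by
  intro h0
  rw [Kdet_eq_fderiv hf] at hK
  have hg := gram_eq_det_sq_mul _ (fderiv_fderiv_symm hf (1, ω)) 1 0 ω 1
  rw [hK, fderiv_fderiv_symm hf _ (1, ω) (0, 1)] at hg
  simp only [fderiv_fderiv_apply_self_of_homogeneous hf hh, h0] at hg
  have h2 : (2 : ℝ) ≤ d := by exact_mod_cast hd
  have h3 : ((d : ℝ) - 1) * fderiv ℝ f (1, ω) (0, 1) ≠ 0 :=
    mul_ne_zero (by linarith) hω
  exact pow_ne_zero 2 h3 (by linarith)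

/-- The linear change of variables sending `(1, ω)` to `(1, 0)` and `(1, s)` to `(0, 1)`. -/
noncomputable def shearEquiv (ω s : ℝ) (h : s - ω ≠ 0) : (ℝ × ℝ) ≃ₗ[ℝ] ℝ × ℝ where
  toFun p := ((s * p.1 - p.2) / (s - ω), (p.2 - ω * p.1) / (s - ω))
  invFun p := (p.1 + p.2, ω * p.1 + s * p.2)
  map_add' p q := by ext <;> simp <;> ring
  map_smul' c p := by ext <;> simp <;> ring
  left_inv p := by ext <;> simp <;> field_simp <;> ring
  right_inv p := by ext <;> simp <;> field_simp <;> ring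

theorem det_shearEquiv (ω s : ℝ) (h : s - ω ≠ 0) :
    LinearMap.det (shearEquiv ω s h : (ℝ × ℝ) →ₗ[ℝ] ℝ × ℝ) = 1 / (s - ω) := by
  have hm : (shearEquiv ω s h : (ℝ × ℝ) →ₗ[ℝ] ℝ × ℝ) =
      Matrix.toLin (Module.Basis.finTwoProd ℝ) (Module.Basis.finTwoProd ℝ)
        !![s / (s - ω), -1 / (s - ω); -ω / (s - ω), 1 / (s - ω)] := by
    rw [Matrix.toLin_finTwoProd]
    ext <;> simp [shearEquiv]
  rw [hm, LinearMap.det_toLin, Matrix.det_fin_two_of]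
  field_simp

/-- Near the direction `ω`, the map `shearEquiv` sends sectors into small sectors about `0`. -/
theorem exists_sector_shearEquiv (ω s : ℝ) (h : s - ω ≠ 0) (ε' : ℝ) (hε' : 0 < ε') :
    ∃ ε : ℝ, 0 < ε ∧ ∀ ξ μ : ℝ, |μ| < |ξ| → |Real.arctan (μ / ξ) - Real.arctan ω| < ε →
      |(shearEquiv ω s h (ξ, μ)).2| < |(shearEquiv ω s h (ξ, μ)).1| ∧
        |Real.arctan ((shearEquiv ω s h (ξ, μ)).2 / (shearEquiv ω s h (ξ, μ)).1)| < ε' := by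
  have htan : ContinuousAt Real.tan (Real.arctan ω) :=
    Real.continuousAt_tan.2 (Real.cos_arctan_pos ω).ne'
  have hs : s - Real.tan (Real.arctan ω) ≠ 0 := by rwa [Real.tan_arctan]
  have hq : ContinuousAt (fun u => (Real.tan u - ω) / (s - Real.tan u)) (Real.arctan ω) :=
    (htan.sub continuousAt_const).div (continuousAt_const.sub htan) hs
  have ha : ContinuousAt (fun u => Real.arctan ((Real.tan u - ω) / (s - Real.tan u)))
      (Real.arctan ω) := Real.continuous_arctan.continuousAt.comp hq
  have hne : ∀ᶠ u in nhds (Real.arctan ω), s - Real.tan u ≠ 0 :=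
    (continuousAt_const.sub htan).eventually_ne hs
  have hq1 := hq.abs.eventually_lt_const (u := 1) (by simp)
  have ha1 := ha.abs.eventually_lt_const (u := ε') (by simpa using hε')
  obtain ⟨ε, hε, H⟩ := Metric.eventually_nhds_iff.1 (hne.and (hq1.and ha1))
  refine ⟨ε, hε, fun ξ μ hlt harc => ?_⟩
  have hξ : ξ ≠ 0 := by
    rintro rfl
    simp only [abs_zero] at hlt
    exact absurd (abs_nonneg μ) (not_le.2 hlt)
  obtain ⟨h1, h2, h3⟩ := H (y := Real.arctan (μ / ξ)) (by rwa [Real.dist_eq])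
  simp only [Real.tan_arctan] at h1 h2 h3
  have hx : (shearEquiv ω s h (ξ, μ)).1 = ξ * (s - μ / ξ) / (s - ω) := by
    simp only [shearEquiv, LinearEquiv.coe_mk, LinearMap.coe_mk, AddHom.coe_mk]
    field_simp
  have hx0 : (shearEquiv ω s h (ξ, μ)).1 ≠ 0 := by
    rw [hx]
    exact div_ne_zero (mul_ne_zero hξ h1) h
  have hr : (shearEquiv ω s h (ξ, μ)).2 / (shearEquiv ω s h (ξ, μ)).1 =
      (μ / ξ - ω) / (s - μ / ξ) := by
    rw [div_eq_div_iff hx0 h1, hx]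
    simp only [shearEquiv, LinearEquiv.coe_mk, LinearMap.coe_mk, AddHom.coe_mk]
    field_simp
  rw [← hr] at h2 h3
  rw [abs_div, div_lt_one (abs_pos.2 hx0)] at h2
  exact ⟨h2, h3⟩

/-- If `ω` is a zero of `K_φ(1,·)` in `[-1,1]` with `φ'(1,ω) ≠ 0`, there is an invertible
linear transformation `T` of `ℝ²` such that, with `(ξ⁰,μ⁰) = T(1,ω)`, `η⁰ = μ⁰/ξ⁰` and
`φⱼ = φ ∘ T⁻¹`:
(i) `ξ⁰ ≠ 0` and `|μ⁰/ξ⁰| < 1/2`;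
(ii) `(det T)² K_{φⱼ}(T(ξ,μ)) = K_φ(ξ,μ)` for all `(ξ,μ)`, and `K_{φⱼ}(1,η⁰) = 0`;
(iii) `φⱼ'(1,η⁰) = 0`;
(iv) for every `ε̃ > 0` there is `ε > 0` such that `T` maps the angular `ε`-sector about
`ω` inside `{|μ| < |ξ|}` into the angular `ε̃`-sector about `η⁰` inside `{|μ| < |ξ|}`. -/
theorem stmt5 (d : ℕ) (hd : 2 ≤ d) (a : ℕ → ℝ) (φ : ℝ → ℝ → ℝ)
    (hφ : ∀ ξ μ : ℝ, φ ξ μ = ∑ i ∈ Finset.range (d + 1), a i * ξ ^ i * μ ^ (d - i))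
    (hK : ∃ η : ℝ, Kdet φ 1 η ≠ 0)
    (ω : ℝ) (hωmem : ω ∈ Set.Icc (-1 : ℝ) 1) (hωzero : Kdet φ 1 ω = 0)
    (hω' : deriv (φ 1) ω ≠ 0) :
    ∃ T : (ℝ × ℝ) ≃ₗ[ℝ] ℝ × ℝ, ∃ φj : ℝ → ℝ → ℝ, ∃ ξ₀ μ₀ η₀ : ℝ,
      (∀ x y : ℝ, φj x y = φ (T.symm (x, y)).1 (T.symm (x, y)).2) ∧
      ξ₀ = (T (1, ω)).1 ∧ μ₀ = (T (1, ω)).2 ∧ η₀ = μ₀ / ξ₀ ∧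
      -- (i)
      ξ₀ ≠ 0 ∧ |μ₀ / ξ₀| < 1 / 2 ∧
      -- (ii)
      (∀ ξ μ : ℝ,
        (LinearMap.det (T : (ℝ × ℝ) →ₗ[ℝ] ℝ × ℝ)) ^ 2 *
            Kdet φj (T (ξ, μ)).1 (T (ξ, μ)).2 = Kdet φ ξ μ) ∧
      Kdet φj 1 η₀ = 0 ∧
      -- (iii)
      deriv (φj 1) η₀ = 0 ∧
      -- (iv)
      (∀ εt : ℝ, 0 < εt → ∃ ε : ℝ, 0 < ε ∧ ∀ ξ μ : ℝ, |μ| < |ξ| →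
        |Real.arctan (μ / ξ) - Real.arctan ω| < ε →
        |(T (ξ, μ)).2| < |(T (ξ, μ)).1| ∧
          |Real.arctan ((T (ξ, μ)).2 / (T (ξ, μ)).1) - Real.arctan η₀| < εt) := by
  set f : ℝ × ℝ → ℝ := fun p => φ p.1 p.2 with hfdef
  have hf : ContDiff ℝ 2 f := by
    simp only [hfdef, hφ]
    fun_prop
  have hfd : Differentiable ℝ f := hf.differentiable (by norm_num)
  have hh (t : ℝ) (p : ℝ × ℝ) : f (t • p) = t ^ d * f p := by
    simp only [hfdef, hφ, Finset.mul_sum, Prod.smul_fst, Prod.smul_snd, smul_eq_mul]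
    refine Finset.sum_congr rfl fun i hi => ?_
    have hi' : i + (d - i) = d := by
      have := Finset.mem_range.1 hi
      omega
    calc a i * (t * p.1) ^ i * (t * p.2) ^ (d - i)
        = t ^ (i + (d - i)) * (a i * p.1 ^ i * p.2 ^ (d - i)) := by ring
      _ = _ := by rw [hi']
  have hB : fderiv ℝ f (1, ω) (0, 1) ≠ 0 := by
    rwa [← (hasDerivAt_prodMk_right f hfd 1 ω).deriv]
  have hE := fderiv_apply_self_ne_zero hf hd hh hωzero hB
  have hlin (x y : ℝ) : fderiv ℝ f (1, ω) (x, y) =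
      x * fderiv ℝ f (1, ω) (1, 0) + y * fderiv ℝ f (1, ω) (0, 1) := by
    have : ((x, y) : ℝ × ℝ) = x • (1, 0) + y • (0, 1) := by simp
    rw [this, map_add, map_smul, map_smul, smul_eq_mul, smul_eq_mul]
  rw [hlin] at hE
  obtain ⟨s, hs⟩ : ∃ s : ℝ, fderiv ℝ f (1, ω) (1, s) = 0 := by
    refine ⟨-fderiv ℝ f (1, ω) (1, 0) / fderiv ℝ f (1, ω) (0, 1), ?_⟩
    rw [hlin]
    field_simp
    ring
  have hsω : s - ω ≠ 0 := by
    intro h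
    rw [hlin, sub_eq_zero.1 h] at hs
    exact hE hs
  have hT1 : shearEquiv ω s hsω (1, ω) = (1, 0) := by
    simp [shearEquiv, hsω]
  set L : ℝ × ℝ →L[ℝ] ℝ × ℝ :=
    LinearMap.toContinuousLinearMap ((shearEquiv ω s hsω).symm : (ℝ × ℝ) →ₗ[ℝ] ℝ × ℝ)
  have hL (p : ℝ × ℝ) : L p = (shearEquiv ω s hsω).symm p := rfl
  have hL1 : L (1, 0) = (1, ω) := by rw [hL, ← hT1, LinearEquiv.symm_apply_apply]
  have hL2 : L (0, 1) = (1, s) := by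
    rw [hL, LinearEquiv.symm_apply_eq]
    simp [shearEquiv, hsω]
  have hKT (ξ μ : ℝ) :
      (LinearMap.det (shearEquiv ω s hsω : (ℝ × ℝ) →ₗ[ℝ] ℝ × ℝ)) ^ 2 *
        Kdet (fun x y => f (L (x, y))) (shearEquiv ω s hsω (ξ, μ)).1
          (shearEquiv ω s hsω (ξ, μ)).2 = Kdet φ ξ μ := by
    rw [Kdet_comp_clm hf L 1 1 ω s hL1 hL2, det_shearEquiv, Prod.mk.eta, hL,
      LinearEquiv.symm_apply_apply, one_mul, one_mul, ← mul_assoc, ← mul_pow,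
      one_div_mul_cancel hsω, one_pow, one_mul]
  refine ⟨shearEquiv ω s hsω, fun x y => f (L (x, y)), 1, 0, 0, fun x y => rfl, by rw [hT1],
    by rw [hT1], by simp, one_ne_zero, by simp, hKT, ?_, ?_, ?_⟩
  · have h := hKT 1 ω
    rw [hT1, hωzero, det_shearEquiv] at h
    exact (mul_eq_zero.1 h).resolve_left (pow_ne_zero 2 (one_div_ne_zero hsω))
  · have hdL : Differentiable ℝ (fun p => f (L p)) := hfd.comp L.differentiable
    rw [(hasDerivAt_prodMk_right (fun p => f (L p)) hdL 1 0).deriv]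
    have h := ((hfd (L (1, 0))).hasFDerivAt.comp (1, 0) L.hasFDerivAt).fderiv
    refine (congrArg (fun A => A (0, 1)) h).trans ?_
    simp [hL1, hL2, hs]
  · intro ε' hε'
    simpa using exists_sector_shearEquiv ω s hsω ε' hε'
end

section
/- For all (ξ₁,ξ₂,η₁,η₂) ∈ ℝ⁴, the Jacobian determinant of V satisfies JV(ξ₁,ξ₂,η₁,η₂) = 2 (ξ₁ξ₂)^d [ (η₂−η₁) φ'(1,η₁) φ'(1,η₂) − d ( φ(1,η₂) φ'(1,η₁) − φ(1,η₁) φ'(1,η₂) ) ]. Equivalently, wherever φ'(1,η₁) ≠ 0 and φ'(1,η₂) ≠ 0, JV = 2(η₂−η₁)(ξ₁ξ₂)^d φ'(1,η₁) φ'(1,η₂) · (G(η₂)−G(η₁))/(η₂−η₁), where G(η) = η − d·φ(1,η)/φ'(1,η). -/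
/-- The change-of-variables map
`V(ξ₁,ξ₂,η₁,η₂) = (ξ₁+ξ₂, ξ₁η₁+ξ₂η₂, ξ₁^d φ(1,η₁)+ξ₂^d φ(1,η₂), ξ₂^d φ(1,η₂)−ξ₁^d φ(1,η₁))`. -/
noncomputable def Vmap (φ : ℝ → ℝ → ℝ) (d : ℕ) :
    ℝ × ℝ × ℝ × ℝ → ℝ × ℝ × ℝ × ℝ := fun p =>
  (p.1 + p.2.1,
   p.1 * p.2.2.1 + p.2.1 * p.2.2.2,
   p.1 ^ d * φ 1 p.2.2.1 + p.2.1 ^ d * φ 1 p.2.2.2,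
   p.2.1 ^ d * φ 1 p.2.2.2 - p.1 ^ d * φ 1 p.2.2.1)

/-- Linear coordinates on `ℝ × ℝ × ℝ × ℝ`. -/
def prodEquivFinFour : (ℝ × ℝ × ℝ × ℝ) ≃ₗ[ℝ] (Fin 4 → ℝ) where
  toFun p := ![p.1, p.2.1, p.2.2.1, p.2.2.2]
  invFun v := (v 0, v 1, v 2, v 3)
  map_add' p q := by ext i; fin_cases i <;> simp
  map_smul' c p := by ext i; fin_cases i <;> simp
  left_inv p := rfl
  right_inv v := by ext i; fin_cases i <;> rfl

theorem prodEquivFinFour_apply (p : ℝ × ℝ × ℝ × ℝ) :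
    prodEquivFinFour p = ![p.1, p.2.1, p.2.2.1, p.2.2.2] := rfl

theorem det_eq_of_prodEquivFinFour (L : (ℝ × ℝ × ℝ × ℝ) →L[ℝ] (ℝ × ℝ × ℝ × ℝ))
    (M : Matrix (Fin 4) (Fin 4) ℝ)
    (h : ∀ p, prodEquivFinFour (L p) = M.mulVec (prodEquivFinFour p)) : L.det = M.det := by
  rw [ContinuousLinearMap.det, ← LinearMap.det_conj _ prodEquivFinFour, ← LinearMap.det_toLin']
  congr 1
  refine LinearMap.ext fun v => ?_
  simp [h]

theorem hasFDerivAt_Vmap {φ : ℝ → ℝ → ℝ} {d : ℕ} {ξ₁ ξ₂ η₁ η₂ b₁ b₂ : ℝ}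
    (h₁ : HasDerivAt (φ 1) b₁ η₁) (h₂ : HasDerivAt (φ 1) b₂ η₂) :
    ∃ L : (ℝ × ℝ × ℝ × ℝ) →L[ℝ] (ℝ × ℝ × ℝ × ℝ),
      HasFDerivAt (Vmap φ d) L (ξ₁, ξ₂, η₁, η₂) ∧
      ∀ p, prodEquivFinFour (L p) = Matrix.mulVec
        !![1, 1, 0, 0;
           η₁, η₂, ξ₁, ξ₂;
           d * ξ₁ ^ (d - 1) * φ 1 η₁, d * ξ₂ ^ (d - 1) * φ 1 η₂, ξ₁ ^ d * b₁, ξ₂ ^ d * b₂;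
           -(d * ξ₁ ^ (d - 1) * φ 1 η₁), d * ξ₂ ^ (d - 1) * φ 1 η₂, -(ξ₁ ^ d * b₁), ξ₂ ^ d * b₂]
        (prodEquivFinFour p) := by
  have hid := hasFDerivAt_id (𝕜 := ℝ) (ξ₁, ξ₂, η₁, η₂)
  have x₁ := hid.fst
  have x₂ := hid.snd.fst
  have y₁ := hid.snd.snd.fst
  have y₂ := hid.snd.snd.snd
  have f₁ := HasDerivAt.comp_hasFDerivAt (ξ₁, ξ₂, η₁, η₂) h₁ y₁
  have f₂ := HasDerivAt.comp_hasFDerivAt (ξ₁, ξ₂, η₁, η₂) h₂ y₂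
  have m₁ := (x₁.pow d).mul f₁
  have m₂ := (x₂.pow d).mul f₂
  refine ⟨_, (x₁.add x₂).prodMk (((x₁.mul y₁).add (x₂.mul y₂)).prodMk
    ((m₁.add m₂).prodMk (m₂.sub m₁))), fun p => ?_⟩
  ext i
  fin_cases i <;>
    simp [prodEquivFinFour_apply, Matrix.mulVec, dotProduct, Fin.sum_univ_four] <;> ring

theorem det_fderiv_Vmap {φ : ℝ → ℝ → ℝ} {d : ℕ} (hd : d ≠ 0) (ξ₁ ξ₂ : ℝ) {η₁ η₂ : ℝ}
    (h₁ : DifferentiableAt ℝ (φ 1) η₁) (h₂ : DifferentiableAt ℝ (φ 1) η₂) :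
    (fderiv ℝ (Vmap φ d) (ξ₁, ξ₂, η₁, η₂)).det =
      2 * (ξ₁ * ξ₂) ^ d *
        ((η₂ - η₁) * deriv (φ 1) η₁ * deriv (φ 1) η₂ -
          d * (φ 1 η₂ * deriv (φ 1) η₁ - φ 1 η₁ * deriv (φ 1) η₂)) := by
  obtain ⟨L, hL, hM⟩ := hasFDerivAt_Vmap (d := d) (ξ₁ := ξ₁) (ξ₂ := ξ₂)
    h₁.hasDerivAt h₂.hasDerivAt
  rw [hL.fderiv, det_eq_of_prodEquivFinFour L _ hM]
  obtain ⟨n, rfl⟩ := Nat.exists_eq_succ_of_ne_zero hd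
  simp [Matrix.det_succ_row_zero, Fin.sum_univ_succ, Fin.succAbove]
  ring

/-- Explicit formula for the Jacobian determinant of `V`, and its expression in terms of
`G(η) = η − d φ(1,η)/φ'(1,η)` where `φ'(1,η₁), φ'(1,η₂) ≠ 0`. -/
theorem stmt9 (d : ℕ) (hd : 2 ≤ d) (a : ℕ → ℝ) (φ : ℝ → ℝ → ℝ)
    (hφ : ∀ ξ μ : ℝ, φ ξ μ = ∑ i ∈ Finset.range (d + 1), a i * ξ ^ i * μ ^ (d - i)) :
    (∀ ξ₁ ξ₂ η₁ η₂ : ℝ,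
      (fderiv ℝ (Vmap φ d) (ξ₁, ξ₂, η₁, η₂)).det =
        2 * (ξ₁ * ξ₂) ^ d *
          ((η₂ - η₁) * deriv (φ 1) η₁ * deriv (φ 1) η₂ -
            d * (φ 1 η₂ * deriv (φ 1) η₁ - φ 1 η₁ * deriv (φ 1) η₂))) ∧
    (∀ ξ₁ ξ₂ η₁ η₂ : ℝ, deriv (φ 1) η₁ ≠ 0 → deriv (φ 1) η₂ ≠ 0 →
      (fderiv ℝ (Vmap φ d) (ξ₁, ξ₂, η₁, η₂)).det =
        2 * (η₂ - η₁) * (ξ₁ * ξ₂) ^ d * deriv (φ 1) η₁ * deriv (φ 1) η₂ *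
          (((η₂ - d * φ 1 η₂ / deriv (φ 1) η₂) - (η₁ - d * φ 1 η₁ / deriv (φ 1) η₁)) /
            (η₂ - η₁))) := by
  have hdiff : Differentiable ℝ (φ 1) := by
    rw [show φ 1 = _ from funext (hφ 1)]
    fun_prop
  have hdet : ∀ ξ₁ ξ₂ η₁ η₂ : ℝ, _ := fun ξ₁ ξ₂ η₁ η₂ =>
    det_fderiv_Vmap (d := d) (by omega) ξ₁ ξ₂ (hdiff η₁) (hdiff η₂)
  refine ⟨hdet, fun ξ₁ ξ₂ η₁ η₂ h₁ h₂ => ?_⟩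
  rw [hdet]
  rcases eq_or_ne η₁ η₂ with rfl | hne
  · simp
  · have hsub : η₂ - η₁ ≠ 0 := sub_ne_zero.mpr hne.symm
    field_simp
    ring
end

section
/- Let φ : ℝ² → ℝ be a homogeneous polynomial of degree d ≥ 2 and define G(η) = η − d·φ(1,η)/φ'(1,η) on the set where φ'(1,η) ≠ 0. Then at every η with φ'(1,η) ≠ 0, G is differentiable and G'(η) = K_φ(1,η) / ( (d−1) · φ'(1,η)² ). -/
theorem hasDerivAt_sum_mul_pow {ι : Type*} (s : Finset ι) (c : ι → ℝ) (e : ι → ℕ) (x : ℝ) :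
    HasDerivAt (fun x => ∑ i ∈ s, c i * x ^ e i)
      (∑ i ∈ s, c i * e i * x ^ (e i - 1)) x := by
  refine HasDerivAt.fun_sum fun i _ => ?_
  simpa [mul_assoc] using (hasDerivAt_pow (e i) x).const_mul (c i)

theorem deriv_sum_mul_pow {ι : Type*} (s : Finset ι) (c : ι → ℝ) (e : ι → ℕ) :
    deriv (fun x => ∑ i ∈ s, c i * x ^ e i) =
      fun x => ∑ i ∈ s, c i * e i * x ^ (e i - 1) :=
  funext fun x => (hasDerivAt_sum_mul_pow s c e x).deriv

theorem iteratedDeriv_two_sum_mul_pow {ι : Type*} (s : Finset ι) (c : ι → ℝ) (e : ι → ℕ) :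
    iteratedDeriv 2 (fun x => ∑ i ∈ s, c i * x ^ e i) =
      fun x => ∑ i ∈ s, c i * e i * (e i - 1 : ℕ) * x ^ (e i - 1 - 1) := by
  rw [iteratedDeriv_succ, iteratedDeriv_one, deriv_sum_mul_pow,
    deriv_sum_mul_pow s (fun i => c i * e i) fun i => e i - 1]

theorem natCast_mul_natCast_sub_one (k : ℕ) : (k : ℝ) * ((k - 1 : ℕ) : ℝ) = k * (k - 1) := by
  cases k <;> simp

theorem mul_natCast_mul_pow_sub_one (k : ℕ) (x : ℝ) : x * (k * x ^ (k - 1)) = k * x ^ k := by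
  cases k with
  | zero => simp
  | succ k => simp only [Nat.add_sub_cancel]; ring

/-- Euler's relation for `∂φ/∂μ` on the line `ξ = 1`. -/
theorem euler_mixed (d : ℕ) (a : ℕ → ℝ) (x : ℝ) :
    ∑ i ∈ Finset.range (d + 1), a i * (d - i : ℕ) * x ^ (d - i - 1) * i =
      (d - 1) * ∑ i ∈ Finset.range (d + 1), a i * (d - i : ℕ) * x ^ (d - i - 1) -
      x * ∑ i ∈ Finset.range (d + 1),
        a i * (d - i : ℕ) * (d - i - 1 : ℕ) * x ^ (d - i - 1 - 1) := by
  simp only [Finset.mul_sum, ← Finset.sum_sub_distrib]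
  refine Finset.sum_congr rfl fun i hi => ?_
  obtain ⟨k, rfl⟩ := Nat.exists_eq_add_of_le (Finset.mem_range_succ_iff.mp hi)
  simp only [Nat.add_sub_cancel_left]
  have h₁ := mul_natCast_mul_pow_sub_one (k - 1) x
  have h₂ := natCast_mul_natCast_sub_one k
  push_cast
  linear_combination (a i * k) * h₁ + a i * x ^ (k - 1) * h₂

/-- The second-order Euler relation for `φ` on the line `ξ = 1`. -/
theorem euler_second (d : ℕ) (a : ℕ → ℝ) (x : ℝ) :
    ∑ i ∈ Finset.range (d + 1), a i * x ^ (d - i) * i * (i - 1 : ℕ) =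
      d * (d - 1) * ∑ i ∈ Finset.range (d + 1), a i * x ^ (d - i) -
      2 * (d - 1) * x * ∑ i ∈ Finset.range (d + 1), a i * (d - i : ℕ) * x ^ (d - i - 1) +
      x ^ 2 * ∑ i ∈ Finset.range (d + 1),
        a i * (d - i : ℕ) * (d - i - 1 : ℕ) * x ^ (d - i - 1 - 1) := by
  simp only [Finset.mul_sum, ← Finset.sum_sub_distrib, ← Finset.sum_add_distrib]
  refine Finset.sum_congr rfl fun i hi => ?_
  obtain ⟨k, rfl⟩ := Nat.exists_eq_add_of_le (Finset.mem_range_succ_iff.mp hi)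
  simp only [Nat.add_sub_cancel_left]
  have h₀ := mul_natCast_mul_pow_sub_one k x
  have h₁ := mul_natCast_mul_pow_sub_one (k - 1) x
  have h₂ := natCast_mul_natCast_sub_one k
  have h₃ := natCast_mul_natCast_sub_one i
  push_cast
  linear_combination a i * x ^ k * h₃ + 2 * (i + k - 1) * a i * h₀ - a i * k * x * h₁
    - a i * x * x ^ (k - 1) * h₂ - a i * (k - 1) * h₀

/-- For a homogeneous polynomial `φ` of degree `d ≥ 2`, the function
`G(η) = η − d φ(1,η)/φ'(1,η)` satisfies `G'(η) = K_φ(1,η)/((d−1) φ'(1,η)²)`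
at every point where `φ'(1,η) ≠ 0`. -/
theorem stmt11 (d : ℕ) (hd : 2 ≤ d) (a : ℕ → ℝ) (φ : ℝ → ℝ → ℝ)
    (hφ : ∀ ξ μ : ℝ, φ ξ μ = ∑ i ∈ Finset.range (d + 1), a i * ξ ^ i * μ ^ (d - i)) :
    ∀ η : ℝ, deriv (φ 1) η ≠ 0 →
      HasDerivAt (fun t => t - (d : ℝ) * φ 1 t / deriv (φ 1) t)
        (Kdet φ 1 η / (((d : ℝ) - 1) * (deriv (φ 1) η) ^ 2)) η := by
  intro η hη
  set S := Finset.range (d + 1)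
  have hφ₁ : φ 1 = fun t => ∑ i ∈ S, a i * t ^ (d - i) := by
    funext t; simp [hφ, S]
  have hf := hasDerivAt_sum_mul_pow S a (fun i => d - i) η
  have hf' := hasDerivAt_sum_mul_pow S (fun i => a i * (d - i : ℕ)) (fun i => d - i - 1) η
  have hd₁ : deriv (φ 1) = fun t => ∑ i ∈ S, a i * (d - i : ℕ) * t ^ (d - i - 1) := by
    rw [hφ₁, deriv_sum_mul_pow S a fun i => d - i]
  have hμμ : iteratedDeriv 2 (φ 1) η =
      ∑ i ∈ S, a i * (d - i : ℕ) * (d - i - 1 : ℕ) * η ^ (d - i - 1 - 1) := by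
    rw [hφ₁, iteratedDeriv_two_sum_mul_pow S a fun i => d - i]
  have hξξ : iteratedDeriv 2 (fun s => φ s η) 1 =
      ∑ i ∈ S, a i * η ^ (d - i) * i * (i - 1 : ℕ) := by
    have h : (fun s => φ s η) = fun s => ∑ i ∈ S, a i * η ^ (d - i) * s ^ i := by
      funext s; rw [hφ]; exact Finset.sum_congr rfl fun i _ => by ring
    rw [h, iteratedDeriv_two_sum_mul_pow S (fun i => a i * η ^ (d - i)) fun i => i]
    simp
  have hξμ : deriv (fun s => deriv (fun t => φ s t) η) 1 =
      ∑ i ∈ S, a i * (d - i : ℕ) * η ^ (d - i - 1) * i := by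
    have h : (fun s => deriv (fun t => φ s t) η) =
        fun s => ∑ i ∈ S, a i * (d - i : ℕ) * η ^ (d - i - 1) * s ^ i := by
      funext s
      simp only [hφ]
      rw [deriv_sum_mul_pow _ (fun i => a i * s ^ i) fun i => d - i]
      exact Finset.sum_congr rfl fun i _ => by ring
    rw [h, deriv_sum_mul_pow S (fun i => a i * (d - i : ℕ) * η ^ (d - i - 1)) fun i => i]
    simp
  have hd' : (d : ℝ) - 1 ≠ 0 := by
    have : (2 : ℝ) ≤ d := by exact_mod_cast hd
    linarith
  rw [euler_second d a η] at hξξ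
  rw [euler_mixed d a η] at hξμ
  unfold Kdet
  rw [hξξ, hξμ, hμμ]
  rw [hd₁] at hη ⊢
  rw [hφ₁]
  refine ((hasDerivAt_id η).sub ((hf.const_mul (d : ℝ)).div hf' hη)).congr_deriv ?_
  simp only at hη ⊢
  field_simp
  ring
end

section
/- Let X be a topological space in which any two distinct points can be joined by a continuous injective path (for all distinct x, y ∈ X there exists a continuous injective φ : [0,1] → X with φ(0) = x, φ(1) = y). Let f : X → ℝ be continuous and locally one-to-one (every point of X has a neighborhood on which f is injective). Then f is injective on X. -/
open Set Filter Topology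

/-- A continuous injective real function on `[a, b]` has no local extremum in `(a, b)`. -/
theorem not_isLocalExtr_of_injOn_Icc {g : ℝ → ℝ} {a b c : ℝ} (hc : c ∈ Ioo a b)
    (hg : ContinuousOn g (Icc a b)) (hinj : InjOn g (Icc a b)) : ¬ IsLocalExtr g c := by
  intro hext
  have left {p : ℝ → Prop} (hp : ∀ᶠ x in 𝓝 c, p x) : ∃ x, p x ∧ x ∈ Ioo a c :=
    ((hp.filter_mono nhdsWithin_le_nhds).and (Ioo_mem_nhdsLT hc.1)).exists
  have right {p : ℝ → Prop} (hp : ∀ᶠ x in 𝓝 c, p x) : ∃ x, p x ∧ x ∈ Ioo c b :=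
    ((hp.filter_mono nhdsWithin_le_nhds).and (Ioo_mem_nhdsGT hc.2)).exists
  have hcm : c ∈ Icc a b := Ioo_subset_Icc_self hc
  rcases hg.strictMonoOn_of_injOn_Icc' (hc.1.trans hc.2).le hinj with hm | hm <;>
    rcases hext with he | he
  · obtain ⟨x, hx, hxm⟩ := left he
    exact (hm ⟨hxm.1.le, (hxm.2.trans hc.2).le⟩ hcm hxm.2).not_ge hx
  · obtain ⟨x, hx, hxm⟩ := right he
    exact (hm hcm ⟨(hc.1.trans hxm.1).le, hxm.2.le⟩ hxm.1).not_ge hx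
  · obtain ⟨x, hx, hxm⟩ := right he
    exact (hm hcm ⟨(hc.1.trans hxm.1).le, hxm.2.le⟩ hxm.1).not_ge hx
  · obtain ⟨x, hx, hxm⟩ := left he
    exact (hm ⟨hxm.1.le, (hxm.2.trans hc.2).le⟩ hcm hxm.2).not_ge hx

/-- A continuous, locally one-to-one real-valued map on a space in which any two distinct
points are joined by a continuous injective path is globally one-to-one. -/
theorem stmt14 (X : Type*) [TopologicalSpace X]
    (harc : ∀ x y : X, x ≠ y →
      ∃ φ : unitInterval → X,
        Continuous φ ∧ Function.Injective φ ∧ φ 0 = x ∧ φ 1 = y)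
    (f : X → ℝ) (hf : Continuous f)
    (hloc : ∀ x : X, ∃ U : Set X, IsOpen U ∧ x ∈ U ∧ Set.InjOn f U) :
    Function.Injective f := by
  intro x y hxy
  by_contra hne
  obtain ⟨φ, hφ, hφinj, rfl, rfl⟩ := harc x y hne
  have hp : Continuous (projIcc (0 : ℝ) 1 zero_le_one) := continuous_projIcc
  set g : ℝ → ℝ := fun t ↦ f (φ (projIcc 0 1 zero_le_one t)) with hgdef
  have hg : Continuous g := hf.comp (hφ.comp hp)
  have hg01 : g 0 = g 1 := by
    simp only [hgdef, projIcc_left, projIcc_right]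
    exact hxy
  obtain ⟨c, hc, hext⟩ := exists_isLocalExtr_Ioo zero_lt_one hg.continuousOn hg01
  obtain ⟨U, hU, hcU, hinj⟩ := hloc (φ (projIcc 0 1 zero_le_one c))
  have hnhds : (fun t ↦ φ (projIcc 0 1 zero_le_one t)) ⁻¹' U ∩ Ioo 0 1 ∈ 𝓝 c :=
    inter_mem ((hφ.comp hp).continuousAt.preimage_mem_nhds (hU.mem_nhds hcU))
      (Ioo_mem_nhds hc.1 hc.2)
  obtain ⟨ε, hε, hball⟩ := Metric.nhds_basis_closedBall.mem_iff.1 hnhds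
  rw [Real.closedBall_eq_Icc] at hball
  refine not_isLocalExtr_of_injOn_Icc (a := c - ε) (b := c + ε)
    ⟨by linarith, by linarith⟩ hg.continuousOn (fun s hs t ht hst ↦ ?_) hext
  have hproj := hφinj (hinj (hball hs).1 (hball ht).1 hst)
  rw [projIcc_of_mem _ (Ioo_subset_Icc_self (hball hs).2),
    projIcc_of_mem _ (Ioo_subset_Icc_self (hball ht).2)] at hproj
  exact congrArg Subtype.val hproj
end

section
/- Let d ≥ 2 be an integer and λ > 1. Then for every real x with 1/λ³ < x < λ³, x > 0 and x ≠ 1, one has 2/λ^{3(d−1)} < d · x^{d−1} · (1 − x²)/(1 − x^d) < 2 · λ^{3(d−1)}. -/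
theorem mul_one_add_le_two_mul_geom_sum {x : ℝ} (hx : 1 ≤ x) (n : ℕ) :
    ((n + 2 : ℕ) : ℝ) * (1 + x) ≤ 2 * ∑ i ∈ Finset.range (n + 2), x ^ i := by
  induction n with
  | zero => simp [Finset.sum_range_succ]
  | succ k ih =>
    have h : x ≤ x ^ (k + 2) := le_self_pow₀ hx (by omega)
    rw [show k + 1 + 2 = (k + 2) + 1 by ring, Finset.sum_range_succ]
    push_cast at ih ⊢
    linarith

theorem two_mul_geom_sum_le_mul_one_add {x : ℝ} (hx0 : 0 ≤ x) (hx : x ≤ 1) (n : ℕ) :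
    2 * ∑ i ∈ Finset.range (n + 2), x ^ i ≤ ((n + 2 : ℕ) : ℝ) * (1 + x) := by
  induction n with
  | zero => simp [Finset.sum_range_succ]
  | succ k ih =>
    have h : x ^ (k + 2) ≤ x := pow_le_of_le_one hx0 hx (by omega)
    rw [show k + 1 + 2 = (k + 2) + 1 by ring, Finset.sum_range_succ]
    push_cast at ih ⊢
    linarith

theorem geom_sum_le_mul_pow {x : ℝ} (hx : 1 ≤ x) (d : ℕ) :
    ∑ i ∈ Finset.range d, x ^ i ≤ d * x ^ (d - 1) := by
  have h := Finset.sum_le_card_nsmul (Finset.range d) (fun i => x ^ i) (x ^ (d - 1))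
    fun i hi => pow_le_pow_right₀ hx (by have := Finset.mem_range.1 hi; omega)
  simpa using h

theorem mul_pow_le_geom_sum {x : ℝ} (hx0 : 0 ≤ x) (hx : x ≤ 1) (d : ℕ) :
    d * x ^ (d - 1) ≤ ∑ i ∈ Finset.range d, x ^ i := by
  have h := Finset.card_nsmul_le_sum (Finset.range d) (fun i => x ^ i) (x ^ (d - 1))
    fun i hi => pow_le_pow_of_le_one hx0 hx (by have := Finset.mem_range.1 hi; omega)
  simpa using h

/-- Bounds for `d x^{d−1} (1−x²)/(1−x^d)` when `1/λ³ < x < λ³`, `x > 0`, `x ≠ 1`. -/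
theorem stmt16 (d : ℕ) (hd : 2 ≤ d) (lam : ℝ) (hlam : 1 < lam) (x : ℝ)
    (hx0 : 0 < x) (hx1 : x ≠ 1) (hlo : 1 / lam ^ 3 < x) (hhi : x < lam ^ 3) :
    2 / lam ^ (3 * (d - 1)) < (d : ℝ) * x ^ (d - 1) * (1 - x ^ 2) / (1 - x ^ d) ∧
      (d : ℝ) * x ^ (d - 1) * (1 - x ^ 2) / (1 - x ^ d) < 2 * lam ^ (3 * (d - 1)) := by
  have hd1 : d - 1 ≠ 0 := by omega
  have hM : 1 < lam ^ (3 * (d - 1)) := one_lt_pow₀ hlam (by omega)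
  have hlow : 1 / lam ^ (3 * (d - 1)) < x ^ (d - 1) := by
    have h := pow_lt_pow_left₀ hlo (by positivity) hd1
    rwa [div_pow, one_pow, ← pow_mul] at h
  have hupp : x ^ (d - 1) < lam ^ (3 * (d - 1)) := by
    have h := pow_lt_pow_left₀ hhi hx0.le hd1
    rwa [← pow_mul] at h
  have hinv : 1 / lam ^ (3 * (d - 1)) < 1 := (div_lt_one (by positivity)).2 hM
  have hP : 0 < x ^ (d - 1) := pow_pos hx0 _
  have hS : 0 < ∑ i ∈ Finset.range d, x ^ i :=
    Finset.sum_pos (fun i _ => pow_pos hx0 i) ⟨0, Finset.mem_range.2 (by omega)⟩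
  have hF : (d : ℝ) * x ^ (d - 1) * (1 - x ^ 2) / (1 - x ^ d) =
      d * x ^ (d - 1) * (1 + x) / ∑ i ∈ Finset.range d, x ^ i := by
    rw [← mul_neg_geom_sum x d,
      show (d : ℝ) * x ^ (d - 1) * (1 - x ^ 2) = (1 - x) * (d * x ^ (d - 1) * (1 + x)) by ring,
      mul_div_mul_left _ _ (sub_ne_zero.2 hx1.symm)]
  have htwo : 2 / lam ^ (3 * (d - 1)) = 2 * (1 / lam ^ (3 * (d - 1))) := by ring
  obtain ⟨n, rfl⟩ := Nat.exists_eq_add_of_le' hd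
  rw [hF, htwo]
  rcases lt_or_gt_of_ne hx1 with hx | hx
  · have h1 := two_mul_geom_sum_le_mul_one_add hx0.le hx.le n
    have h2 := mul_pow_le_geom_sum hx0.le hx.le (n + 2)
    constructor
    · refine lt_of_lt_of_le (mul_lt_mul_of_pos_left hlow two_pos) ((le_div_iff₀ hS).2 ?_)
      linarith [mul_le_mul_of_nonneg_left h1 hP.le]
    · refine lt_of_le_of_lt ((div_le_iff₀ hS).2 (?_ : _ ≤ (1 + x) * _)) (by linarith)
      linarith [mul_le_mul_of_nonneg_right h2 (by linarith : 0 ≤ 1 + x)]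
  · have h1 := mul_one_add_le_two_mul_geom_sum hx.le n
    have h2 := geom_sum_le_mul_pow hx.le (n + 2)
    constructor
    · refine lt_of_lt_of_le (by linarith : _ < 1 + x) ((le_div_iff₀ hS).2 ?_)
      linarith [mul_le_mul_of_nonneg_right h2 (by linarith : 0 ≤ 1 + x)]
    · refine lt_of_le_of_lt ((div_le_iff₀ hS).2 ?_) (mul_lt_mul_of_pos_left hupp two_pos)
      linarith [mul_le_mul_of_nonneg_left h1 hP.le]
end

section
/- Let 0 ≤ a < b, let D > 0, and let F : [a,b] → ℝ be continuous, strictly positive, and differentiable on (a,b), with (F(z)²)' ≤ −2Dz for all z ∈ (a,b). Then F(z)² ≥ F(b)² + D(b² − z²) for all z ∈ [a,b], and consequently ∫_a^b dz / F(z) ≤ π / (2√D). -/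
/-- If `F > 0` is continuous on `[a,b]` (`0 ≤ a < b`), differentiable on `(a,b)` with
`(F²)' ≤ −2Dz`, then `F(z)² ≥ F(b)² + D(b²−z²)` on `[a,b]` and
`∫_a^b dz/F(z) ≤ π/(2√D)`. -/
theorem stmt18 (a b D : ℝ) (ha : 0 ≤ a) (hab : a < b) (hD : 0 < D)
    (F : ℝ → ℝ) (hFc : ContinuousOn F (Set.Icc a b))
    (hFpos : ∀ z ∈ Set.Icc a b, 0 < F z)
    (hdiff : ∀ z ∈ Set.Ioo a b, DifferentiableAt ℝ F z)
    (hder : ∀ z ∈ Set.Ioo a b, deriv (fun w => F w ^ 2) z ≤ -2 * D * z) :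
    (∀ z ∈ Set.Icc a b, F b ^ 2 + D * (b ^ 2 - z ^ 2) ≤ F z ^ 2) ∧
      ∫ z in a..b, 1 / F z ≤ Real.pi / (2 * Real.sqrt D) := by
  have hb : 0 < b := ha.trans_lt hab
  have hanti : AntitoneOn (fun w => F w ^ 2 + D * w ^ 2) (Set.Icc a b) := by
    have hderiv : ∀ z ∈ Set.Ioo a b, HasDerivAt (fun w => F w ^ 2 + D * w ^ 2)
        (deriv (fun w => F w ^ 2) z + D * (2 * z)) z := by
      intro z hz
      have h1 : HasDerivAt (fun w => F w ^ 2) (deriv (fun w => F w ^ 2) z) z :=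
        ((hdiff z hz).pow 2).hasDerivAt
      have h2 : HasDerivAt (fun w : ℝ => D * w ^ 2) (D * (2 * z)) z := by
        simpa using (hasDerivAt_pow 2 z).const_mul D
      exact h1.add h2
    refine antitoneOn_of_deriv_nonpos (convex_Icc a b) (by fun_prop) ?_ ?_ <;>
      rw [interior_Icc]
    · exact fun z hz => (hderiv z hz).differentiableAt.differentiableWithinAt
    · intro z hz
      rw [(hderiv z hz).deriv]
      linarith [hder z hz]
  have hlow : ∀ z ∈ Set.Icc a b, F b ^ 2 + D * (b ^ 2 - z ^ 2) ≤ F z ^ 2 := by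
    intro z hz
    have h := hanti hz (Set.right_mem_Icc.mpr hab.le) hz.2
    simp only at h
    linarith
  refine ⟨hlow, ?_⟩
  have hsD : 0 < √D := Real.sqrt_pos.mpr hD
  have hint : ∫ z in a..b, 1 / F z ≤
      Real.arcsin (b / b) / √D - Real.arcsin (a / b) / √D := by
    refine intervalIntegral.integral_le_sub_of_hasDeriv_right_of_le
      (g := fun z => Real.arcsin (z / b) / √D)
      (g' := fun z => 1 / √(1 - (z / b) ^ 2) * (1 / b) / √D) hab.le
      (by fun_prop) ?_ ?_ ?_
    · intro z hz
      have hlt : z / b < 1 := (div_lt_one hb).mpr hz.2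
      have hgt : 0 ≤ z / b := div_nonneg (ha.trans hz.1.le) hb.le
      exact (((Real.hasDerivAt_arcsin (by linarith) hlt.ne).comp z
        ((hasDerivAt_id z).div_const b)).div_const _).hasDerivWithinAt
    · exact (continuousOn_const.div hFc fun z hz => (hFpos z hz).ne').integrableOn_Icc
    · intro z hz
      have hz' := Set.Ioo_subset_Icc_self hz
      have hlt : z / b < 1 := (div_lt_one hb).mpr hz.2
      have hgt : 0 ≤ z / b := div_nonneg (ha.trans hz.1.le) hb.le
      have hpos : 0 < 1 - (z / b) ^ 2 := by nlinarith
      have hs : 0 < √(1 - (z / b) ^ 2) := Real.sqrt_pos.mpr hpos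
      have hle : √(1 - (z / b) ^ 2) * b * √D ≤ F z := by
        refine (abs_le_of_sq_le_sq' ?_ (hFpos z hz').le).2
        rw [mul_pow, mul_pow, Real.sq_sqrt hpos.le, Real.sq_sqrt hD.le]
        have : (1 - (z / b) ^ 2) * b ^ 2 * D = D * (b ^ 2 - z ^ 2) := by
          field_simp
        nlinarith [hlow z hz', sq_nonneg (F b)]
      calc 1 / F z ≤ 1 / (√(1 - (z / b) ^ 2) * b * √D) :=
            one_div_le_one_div_of_le (by positivity) hle
        _ = 1 / √(1 - (z / b) ^ 2) * (1 / b) / √D := by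
            field_simp
  have harc : 0 ≤ Real.arcsin (a / b) / √D :=
    div_nonneg (Real.arcsin_nonneg.mpr (div_nonneg ha hb.le)) hsD.le
  rw [div_self hb.ne', Real.arcsin_one, div_div] at hint
  linarith
end
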